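/- Let A = σ(R)⟨x_1,…,x_n⟩ be a skew PBW extension of a ring R. For each α ∈ ℕ^n and each nonzero r ∈ R, there exist unique elements r_α = σ^α(r) ∈ R \ {0} and p_{α,r} ∈ A such that x^α r = σ^α(r) x^α + p_{α,r}, where either p_{α,r} = 0 or the total degree of p_{α,r} is strictly less than |α| = α_1 + ⋯ + α_n; moreover, if r is left invertible in R then so is σ^α(r). -/

import Mathlib

/-! Basic annihilator-condition definitions for (noncommutative) rings. -/

/-- The right annihilator `r_S(X) = {a ∈ S | Xa = 0}` of a subset `X` of a ring `S`. -/
def rAnn {S : Type*} [Ring S] (X : Set S) : Set S := {a | ∀ x ∈ X, x * a = 0}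

/-- The left annihilator `ℓ_S(X) = {a ∈ S | aX = 0}` of a subset `X` of a ring `S`. -/
def lAnn {S : Type*} [Ring S] (X : Set S) : Set S := {a | ∀ x ∈ X, a * x = 0}

/-- The principal right ideal `xS` of a ring `S`. -/
def rIdeal {S : Type*} [Ring S] (x : S) : Set S := Set.range fun s => x * s

/-- The principal left ideal `Sx` of a ring `S`. -/
def lIdeal {S : Type*} [Ring S] (x : S) : Set S := Set.range fun s => s * x

/-- A ring `S` is Baer if the right annihilator of every nonempty subset is
generated (as a right ideal) by an idempotent. -/
def IsBaerRing (S : Type*) [Ring S] : Prop :=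
  ∀ X : Set S, X.Nonempty → ∃ e : S, e * e = e ∧ rAnn X = rIdeal e

/-- A ring `S` is a right p.p.-ring if the right annihilator of every element is
generated by an idempotent. -/
def IsRightPP (S : Type*) [Ring S] : Prop :=
  ∀ a : S, ∃ e : S, e * e = e ∧ rAnn {a} = rIdeal e

/-- A ring `S` is a left p.p.-ring if the left annihilator of every element is
generated by an idempotent. -/
def IsLeftPP (S : Type*) [Ring S] : Prop :=
  ∀ a : S, ∃ e : S, e * e = e ∧ lAnn {a} = lIdeal e

/-- A ring `S` is right p.q.-Baer if the right annihilator of every principal right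
ideal is generated by an idempotent. -/
def IsRightPQBaer (S : Type*) [Ring S] : Prop :=
  ∀ a : S, ∃ e : S, e * e = e ∧ rAnn (rIdeal a) = rIdeal e

/-- A ring `S` is left p.q.-Baer if the left annihilator of every principal left
ideal is generated by an idempotent. -/
def IsLeftPQBaer (S : Type*) [Ring S] : Prop :=
  ∀ a : S, ∃ e : S, e * e = e ∧ lAnn (lIdeal a) = lIdeal e

/-- Property (a.c.) on the right: for every finitely generated right ideal
`I = a₁S + ⋯ + a_mS` there is `c` with `r_S(I) = r_S(cS)`. -/
def HasRightAC (S : Type*) [Ring S] : Prop :=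
  ∀ (m : ℕ) (a : Fin m → S), ∃ c : S,
    rAnn {y : S | ∃ s : Fin m → S, y = ∑ i, a i * s i} = rAnn (rIdeal c)

/-- Property (a.c.) on the left: for every finitely generated left ideal
`I = Sa₁ + ⋯ + Sa_m` there is `c` with `ℓ_S(I) = ℓ_S(Sc)`. -/
def HasLeftAC (S : Type*) [Ring S] : Prop :=
  ∀ (m : ℕ) (a : Fin m → S), ∃ c : S,
    lAnn {y : S | ∃ s : Fin m → S, y = ∑ i, s i * a i} = lAnn (lIdeal c)

/-- A ring is Abelian if every idempotent is central. -/
def IsAbelianRing (S : Type*) [Ring S] : Prop :=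
  ∀ e : S, e * e = e → ∀ r : S, e * r = r * e

/-- A ring `S` is NI if the set of nilpotent elements coincides with the upper
nilradical `nil*(S)`, the sum of all (two-sided) nil ideals of `S`. -/
def IsNIRing (S : Type*) [Ring S] : Prop :=
  {a : S | IsNilpotent a} =
    ((sSup {I : TwoSidedIdeal S | ∀ x ∈ I, IsNilpotent x} : TwoSidedIdeal S) : Set S)

/-- `σ^α = σ₁^{α₁} ∘ ⋯ ∘ σₙ^{αₙ}` for a family of ring endomorphisms. -/
def sigmaPow {R : Type*} [Ring R] {n : ℕ} (σ : Fin n → R →+* R) (α : Fin n → ℕ) : R → R :=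
  (List.ofFn fun i => (⇑(σ i))^[α i]).foldr (· ∘ ·) id

/-- `δ^α = δ₁^{α₁} ∘ ⋯ ∘ δₙ^{αₙ}` for a family of maps. -/
def deltaPow {R : Type*} {n : ℕ} (δ : Fin n → R → R) (α : Fin n → ℕ) : R → R :=
  (List.ofFn fun i => (δ i)^[α i]).foldr (· ∘ ·) id

/-- The ordered standard monomial `x^α = x₁^{α₁} ⋯ xₙ^{αₙ}`. -/
def monom {A : Type*} [Ring A] {n : ℕ} (x : Fin n → A) (α : Fin n → ℕ) : A :=
  (List.ofFn fun i => x i ^ α i).prod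

/-- A skew PBW extension `A = σ(R)⟨x₁,…,xₙ⟩` of a ring `R`:
`R` embeds in `A` (sharing the identity), `A` is a free left `R`-module with basis the
standard monomials, there are injective endomorphisms `σᵢ` and `σᵢ`-derivations `δᵢ`
with `xᵢ r = σᵢ(r) xᵢ + δᵢ(r)`, and `xⱼxᵢ - d_{i,j} xᵢxⱼ ∈ R + Rx₁ + ⋯ + Rxₙ`
with `d_{i,j} ≠ 0`. -/
structure SkewPBWExt (R A : Type*) [Ring R] [Ring A] (n : ℕ) where
  /-- the inclusion of `R` into `A` -/
  ι : R →+* A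
  ι_inj : Function.Injective ι
  /-- the variables `x₁, …, xₙ` -/
  x : Fin n → A
  /-- the endomorphisms `σᵢ` -/
  σ : Fin n → R →+* R
  σ_inj : ∀ i, Function.Injective (σ i)
  /-- the `σᵢ`-derivations `δᵢ` -/
  δ : Fin n → R → R
  δ_add : ∀ (i : Fin n) (a b : R), δ i (a + b) = δ i a + δ i b
  δ_leibniz : ∀ (i : Fin n) (a b : R), δ i (a * b) = σ i a * δ i b + δ i a * b
  comm_rel : ∀ (i : Fin n) (r : R), x i * ι r = ι (σ i r) * x i + ι (δ i r)
  /-- `A` is a free left `R`-module with basis the standard monomials: every element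
  has a unique representation as a finite left `R`-linear combination of monomials. -/
  basis : ∀ f : A, ∃! c : (Fin n → ℕ) →₀ R, f = c.sum fun α r => ι r * monom x α
  /-- the constants `d_{i,j}` -/
  d : Fin n → Fin n → R
  d_ne : ∀ i j, d i j ≠ 0
  quad : ∀ i j, ∃ (r0 : R) (rc : Fin n → R),
    x j * x i - ι (d i j) * (x i * x j) = ι r0 + ∑ k, ι (rc k) * x k

namespace SkewPBWExt

variable {R A : Type*} [Ring R] [Ring A] {n : ℕ}

/-- `R` is `(Σ,Δ)`-compatible. -/
def SigmaDeltaCompatible (E : SkewPBWExt R A n) : Prop :=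
  ∀ (a b : R) (α : Fin n → ℕ),
    (a * b = 0 ↔ a * sigmaPow E.σ α b = 0) ∧ (a * b = 0 → a * deltaPow E.δ α b = 0)

/-- `R` is `Σ`-rigid. -/
def SigmaRigid (E : SkewPBWExt R A n) : Prop :=
  ∀ (a : R) (α : Fin n → ℕ), a * sigmaPow E.σ α a = 0 → a = 0

/-- Condition (SA1): if `fg = 0` in `A` then all products of coefficients vanish. -/
def SA1 (E : SkewPBWExt R A n) : Prop :=
  ∀ cf cg : (Fin n → ℕ) →₀ R,
    (cf.sum fun α r => E.ι r * monom E.x α) * (cg.sum fun β r => E.ι r * monom E.x β) = 0 →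
    ∀ α β, cf α * cg β = 0

/-- The extension is bijective: every `σᵢ` is bijective and every `d_{i,j}` (`i < j`)
is invertible in `R`. -/
def Bijective (E : SkewPBWExt R A n) : Prop :=
  (∀ i, Function.Bijective (E.σ i)) ∧ ∀ i j : Fin n, i < j → IsUnit (E.d i j)

end SkewPBWExt


theorem List.prod_ofFn_mul_left {M : Type*} [Monoid M] {n : ℕ} (y z : Fin n → M) (a : M)
    (i : Fin n) (hlt : ∀ j < i, y j = 1) (hi : z i = a * y i) (hne : ∀ j ≠ i, z j = y j) :
    (List.ofFn z).prod = a * (List.ofFn y).prod := by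
  induction n with
  | zero => exact i.elim0
  | succ n ih =>
    rw [List.ofFn_succ, List.ofFn_succ, List.prod_cons, List.prod_cons]
    induction i using Fin.cases with
    | zero =>
      rw [hi, mul_assoc]
      congr 4
      funext j
      exact hne _ (Fin.succ_ne_zero j)
    | succ i =>
      rw [hne 0 (Fin.succ_ne_zero i).symm, hlt 0 (Fin.succ_pos i), one_mul, one_mul]
      exact ih _ _ i (fun j hj => hlt _ (Fin.succ_lt_succ_iff.2 hj)) hi
        fun j hj => hne _ fun h => hj (Fin.succ_injective _ h)

/-- Multi-indices are built from `0` by raising entries at or before the first nonzero one. -/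
theorem Fin.multiIndex_induction {n : ℕ} {P : (Fin n → ℕ) → Prop} (zero : P 0)
    (add_single : ∀ (β : Fin n → ℕ) (i : Fin n), (∀ j < i, β j = 0) → P β → P (β + Pi.single i 1))
    (α : Fin n → ℕ) : P α := by
  induction hN : ∑ i, α i generalizing α with
  | zero =>
    have : α = 0 := by
      funext i
      exact Finset.sum_eq_zero_iff.1 hN i (Finset.mem_univ i)
    exact this ▸ zero
  | succ N ih =>
    have hex : ∃ i, α i ≠ 0 := by
      by_contra! h
      simp [h] at hN
    obtain ⟨i, hi, hmin⟩ := wellFounded_lt.has_min {i | α i ≠ 0} hex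
    have hα : α = (α - Pi.single i 1) + Pi.single i 1 := by
      funext j
      rcases eq_or_ne j i with rfl | hj
      · have : α j ≠ 0 := hi
        simp
        omega
      · simp [hj]
    rw [hα]
    refine add_single _ i (fun j hj => ?_) (ih _ ?_)
    · have : α j = 0 := by
        by_contra h
        exact hmin j h hj
      simp [this]
    · rw [hα] at hN
      simp only [Pi.add_apply, Finset.sum_add_distrib, Finset.sum_pi_single', Finset.mem_univ,
        if_true] at hN
      simpa using hN

theorem monom_add_single {A : Type*} [Ring A] {n : ℕ} (x : Fin n → A) (β : Fin n → ℕ) (i : Fin n)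
    (h : ∀ j < i, β j = 0) : monom x (β + Pi.single i 1) = x i * monom x β := by
  refine List.prod_ofFn_mul_left _ _ _ i (fun j hj => ?_) ?_ fun j hj => ?_
  · simp [h j hj]
  · simp [pow_succ']
  · simp [hj]

theorem sigmaPow_add_single {R : Type*} [Ring R] {n : ℕ} (σ : Fin n → R →+* R) (β : Fin n → ℕ)
    (i : Fin n) (h : ∀ j < i, β j = 0) (r : R) :
    sigmaPow σ (β + Pi.single i 1) r = σ i (sigmaPow σ β r) := by
  refine congrFun (List.prod_ofFn_mul_left (M := Function.End R) (fun j => (⇑(σ j))^[β j])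
    (fun j => (⇑(σ j))^[(β + Pi.single i 1 : Fin n → ℕ) j]) (⇑(σ i)) i (fun j hj => ?_) ?_ fun j hj => ?_) r
  · simp only [h j hj]
    rfl
  · simp only [Pi.add_apply, Pi.single_eq_same, Function.iterate_succ']
    rfl
  · simp only [Pi.add_apply, Pi.single_eq_of_ne hj, add_zero]
    rfl

theorem sigmaPow_zero {R : Type*} [Ring R] {n : ℕ} (σ : Fin n → R →+* R) (r : R) :
    sigmaPow σ 0 r = r := by
  have h : (List.ofFn fun _ : Fin n => (1 : Function.End R)).prod = 1 :=
    List.prod_eq_one (by simp)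
  exact congrFun h r

theorem monom_zero {A : Type*} [Ring A] {n : ℕ} (x : Fin n → A) : monom x 0 = 1 :=
  List.prod_eq_one (by simp)

theorem exists_ringHom_eq_sigmaPow {R : Type*} [Ring R] {n : ℕ} (σ : Fin n → R →+* R)
    (hσ : ∀ i, Function.Injective (σ i)) (α : Fin n → ℕ) :
    ∃ φ : R →+* R, Function.Injective φ ∧ ∀ r, sigmaPow σ α r = φ r := by
  induction α using Fin.multiIndex_induction with
  | zero => exact ⟨RingHom.id R, fun _ _ h => h, sigmaPow_zero σ⟩
  | add_single β i h ih =>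
    obtain ⟨φ, hφ, hr⟩ := ih
    refine ⟨(σ i).comp φ, (hσ i).comp hφ, fun r => ?_⟩
    rw [sigmaPow_add_single σ β i h, hr, RingHom.comp_apply]

namespace SkewPBWExt

variable {R A : Type*} [Ring R] [Ring A] {n : ℕ}

/-- The left `R`-combinations of the monomials `x^β` with `β < α` componentwise. -/
def below (E : SkewPBWExt R A n) (α : Fin n → ℕ) : AddSubgroup A :=
  AddSubgroup.closure {a | ∃ (s : R) (β : Fin n → ℕ), β < α ∧ a = E.ι s * monom E.x β}

theorem mul_monom_mem_below (E : SkewPBWExt R A n) {α β : Fin n → ℕ} (h : β < α) (s : R) :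
    E.ι s * monom E.x β ∈ E.below α :=
  AddSubgroup.subset_closure ⟨s, β, h, rfl⟩

theorem x_mul_mul_monom (E : SkewPBWExt R A n) (β : Fin n → ℕ) (i : Fin n)
    (h : ∀ j < i, β j = 0) (s : R) :
    E.x i * (E.ι s * monom E.x β) =
      E.ι (E.σ i s) * monom E.x (β + Pi.single i 1) + E.ι (E.δ i s) * monom E.x β := by
  rw [monom_add_single E.x β i h, ← mul_assoc, E.comm_rel, add_mul, mul_assoc]

theorem lt_add_single (β : Fin n → ℕ) (i : Fin n) : β < β + Pi.single i 1 :=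
  lt_add_of_pos_right β (by simp [Pi.lt_def]; exact ⟨i, by simp⟩)

theorem x_mul_mem_below (E : SkewPBWExt R A n) (β : Fin n → ℕ) (i : Fin n)
    (h : ∀ j < i, β j = 0) {q : A} (hq : q ∈ E.below β) :
    E.x i * q ∈ E.below (β + Pi.single i 1) := by
  induction hq using AddSubgroup.closure_induction with
  | mem q hq =>
    obtain ⟨s, γ, hγ, rfl⟩ := hq
    have hγ0 : ∀ j < i, γ j = 0 := fun j hj => Nat.le_zero.1 (h j hj ▸ hγ.le j)
    rw [E.x_mul_mul_monom γ i hγ0]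
    exact add_mem (E.mul_monom_mem_below (by gcongr) _)
      (E.mul_monom_mem_below (hγ.trans (lt_add_single β i)) _)
  | zero => simp
  | add a b _ _ ha hb => rw [mul_add]; exact add_mem ha hb
  | neg a _ ha => rw [mul_neg]; exact neg_mem ha

theorem monom_mul_sub_mem_below (E : SkewPBWExt R A n) (α : Fin n → ℕ) (r : R) :
    monom E.x α * E.ι r - E.ι (sigmaPow E.σ α r) * monom E.x α ∈ E.below α := by
  induction α using Fin.multiIndex_induction with
  | zero => simp [monom_zero, sigmaPow_zero]
  | add_single β i h ih =>
    have key : monom E.x (β + Pi.single i 1) * E.ι r -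
        E.ι (sigmaPow E.σ (β + Pi.single i 1) r) * monom E.x (β + Pi.single i 1) =
        E.x i * (monom E.x β * E.ι r - E.ι (sigmaPow E.σ β r) * monom E.x β) +
          E.ι (E.δ i (sigmaPow E.σ β r)) * monom E.x β := by
      rw [mul_sub, E.x_mul_mul_monom β i h, sigmaPow_add_single E.σ β i h,
        monom_add_single E.x β i h, mul_assoc]
      abel
    rw [key]
    exact add_mem (E.x_mul_mem_below β i h ih) (E.mul_monom_mem_below (lt_add_single β i) _)

/-- The element of `A` with the given coefficients in the monomial basis. -/
noncomputable def ofCoeffs (E : SkewPBWExt R A n) : ((Fin n → ℕ) →₀ R) →+ A :=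
  Finsupp.liftAddHom fun β => (AddMonoidHom.mulRight (monom E.x β)).comp E.ι.toAddMonoidHom

theorem ofCoeffs_apply (E : SkewPBWExt R A n) (c : (Fin n → ℕ) →₀ R) :
    E.ofCoeffs c = c.sum fun β s => E.ι s * monom E.x β :=
  rfl

theorem ofCoeffs_single (E : SkewPBWExt R A n) (β : Fin n → ℕ) (s : R) :
    E.ofCoeffs (Finsupp.single β s) = E.ι s * monom E.x β := by
  simp [ofCoeffs]

theorem ofCoeffs_injective (E : SkewPBWExt R A n) : Function.Injective E.ofCoeffs :=
  fun c _ h => (E.basis (E.ofCoeffs c)).unique rfl h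

theorem exists_coeffs_of_mem_below (E : SkewPBWExt R A n) {α : Fin n → ℕ} {p : A}
    (hp : p ∈ E.below α) :
    ∃ c : (Fin n → ℕ) →₀ R, p = E.ofCoeffs c ∧ ∀ β ∈ c.support, ∑ i, β i < ∑ i, α i := by
  classical
  induction hp using AddSubgroup.closure_induction with
  | mem p hp =>
    obtain ⟨s, β, hβ, rfl⟩ := hp
    refine ⟨Finsupp.single β s, (E.ofCoeffs_single β s).symm, fun γ hγ => ?_⟩
    rw [Finset.mem_singleton.1 (Finsupp.support_single_subset hγ)]
    obtain ⟨hle, i, hi⟩ := Pi.lt_def.1 hβ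
    exact Finset.sum_lt_sum (fun j _ => hle j) ⟨i, Finset.mem_univ i, hi⟩
  | zero => exact ⟨0, by simp, by simp⟩
  | add a b _ _ ha hb =>
    obtain ⟨c, rfl, hc⟩ := ha
    obtain ⟨d, rfl, hd⟩ := hb
    exact ⟨c + d, (map_add _ _ _).symm, fun β hβ =>
      (Finset.mem_union.1 (Finsupp.support_add hβ)).elim (hc β) (hd β)⟩
  | neg a _ ha =>
    obtain ⟨c, rfl, hc⟩ := ha
    exact ⟨-c, (map_neg _ _).symm, fun β hβ => hc β (by simpa using hβ)⟩

/-- The coefficient of `x^α` is determined modulo terms of smaller total degree. -/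
theorem coeff_unique (E : SkewPBWExt R A n) {α : Fin n → ℕ} {s t : R}
    {c d : (Fin n → ℕ) →₀ R} (hc : ∀ β ∈ c.support, ∑ i, β i < ∑ i, α i)
    (hd : ∀ β ∈ d.support, ∑ i, β i < ∑ i, α i)
    (h : E.ι s * monom E.x α + E.ofCoeffs c = E.ι t * monom E.x α + E.ofCoeffs d) : s = t := by
  have hcα : c α = 0 := Finsupp.notMem_support_iff.1 fun hα => (hc α hα).false
  have hdα : d α = 0 := Finsupp.notMem_support_iff.1 fun hα => (hd α hα).false
  rw [← E.ofCoeffs_single, ← E.ofCoeffs_single, ← map_add, ← map_add] at h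
  simpa [hcα, hdα] using DFunLike.congr_fun (E.ofCoeffs_injective h) α

end SkewPBWExt

/-- For each `α ∈ ℕⁿ` and each nonzero `r ∈ R` there are unique elements
`r_α ∈ R \\ {0}` and `p_{α,r} ∈ A` with `x^α r = r_α x^α + p_{α,r}`, where
`p_{α,r} = 0` or `deg p_{α,r} < |α|`; moreover `r_α = σ^α(r)`, and it is left
invertible whenever `r` is. -/
theorem monom_mul_coeff {R A : Type*} [Ring R] [Ring A] {n : ℕ} (E : SkewPBWExt R A n)
    (α : Fin n → ℕ) (r : R) (hr : r ≠ 0) :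
    sigmaPow E.σ α r ≠ 0 ∧
    (∃! rp : R × A,
      monom E.x α * E.ι r = E.ι rp.1 * monom E.x α + rp.2 ∧
      (rp.2 = 0 ∨ ∃ c : (Fin n → ℕ) →₀ R,
        rp.2 = c.sum (fun β s => E.ι s * monom E.x β) ∧
        ∀ β ∈ c.support, (∑ i, β i) < ∑ i, α i)) ∧
    (∀ rp : R × A,
      (monom E.x α * E.ι r = E.ι rp.1 * monom E.x α + rp.2 ∧
       (rp.2 = 0 ∨ ∃ c : (Fin n → ℕ) →₀ R,
         rp.2 = c.sum (fun β s => E.ι s * monom E.x β) ∧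
         ∀ β ∈ c.support, (∑ i, β i) < ∑ i, α i)) →
      rp.1 = sigmaPow E.σ α r) ∧
    ((∃ u : R, u * r = 1) → ∃ u : R, u * sigmaPow E.σ α r = 1) := by
  obtain ⟨φ, hφ, hσ⟩ := exists_ringHom_eq_sigmaPow E.σ E.σ_inj α
  obtain ⟨c, hc, hcα⟩ := E.exists_coeffs_of_mem_below (E.monom_mul_sub_mem_below α r)
  rw [sub_eq_iff_eq_add'] at hc
  have huniq : ∀ rp : R × A,
      (monom E.x α * E.ι r = E.ι rp.1 * monom E.x α + rp.2 ∧
       (rp.2 = 0 ∨ ∃ c : (Fin n → ℕ) →₀ R,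
         rp.2 = c.sum (fun β s => E.ι s * monom E.x β) ∧
         ∀ β ∈ c.support, (∑ i, β i) < ∑ i, α i)) →
      rp.1 = sigmaPow E.σ α r := by
    rintro ⟨s, p⟩ ⟨hsp, hp⟩
    have hd : ∃ d : (Fin n → ℕ) →₀ R, p = E.ofCoeffs d ∧
        ∀ β ∈ d.support, ∑ i, β i < ∑ i, α i :=
      hp.elim (fun h => ⟨0, by simpa using h, by simp⟩) id
    obtain ⟨d, rfl, hdα⟩ := hd
    exact E.coeff_unique hdα hcα (hsp.symm.trans hc)
  refine ⟨?_, ⟨(sigmaPow E.σ α r, E.ofCoeffs c), ⟨hc, Or.inr ⟨c, rfl, hcα⟩⟩, ?_⟩, huniq, ?_⟩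
  · rw [hσ]
    exact (map_ne_zero_iff φ hφ).2 hr
  · rintro ⟨s, p⟩ hsp
    obtain rfl : s = sigmaPow E.σ α r := huniq _ hsp
    exact Prod.ext rfl (add_left_cancel (hsp.1.symm.trans hc))
  · rintro ⟨u, hu⟩
    exact ⟨φ u, by rw [hσ, ← map_mul, hu, map_one]⟩
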